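/- Let G be a splitgraph on n vertices with split partition {S, C}, where C is nonempty, and let d be the minimum degree in G of a vertex of C. Then the maximum of |I|/(|I| + |N(I)|), taken over all independent sets I of G containing exactly one vertex of C, equals (n − d)/n. -/

import Mathlib

/-- The (open) neighborhood of a set of vertices: all vertices outside `I`
having a neighbor in `I`. -/
def setNbhd {V : Type*} [Fintype V] [DecidableEq V]
    (G : SimpleGraph V) [DecidableRel G.Adj] (I : Finset V) : Finset V :=
  Finset.univ.filter (fun v => v ∉ I ∧ ∃ a ∈ I, G.Adj v a)

theorem neighborFinset_subset_setNbhd {V : Type*} [Fintype V] [DecidableEq V]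
    (G : SimpleGraph V) [DecidableRel G.Adj] {I : Finset V}
    (hI : ∀ a ∈ I, ∀ b ∈ I, ¬ G.Adj a b) {v : V} (hv : v ∈ I) :
    G.neighborFinset v ⊆ setNbhd G I := by
  intro w hw
  rw [SimpleGraph.mem_neighborFinset] at hw
  simp only [setNbhd, Finset.mem_filter, Finset.mem_univ, true_and]
  exact ⟨fun h => hI v hv w h hw, v, hv, hw.symm⟩

theorem card_add_degree_le {V : Type*} [Fintype V] [DecidableEq V]
    (G : SimpleGraph V) [DecidableRel G.Adj] {I : Finset V}
    (hI : ∀ a ∈ I, ∀ b ∈ I, ¬ G.Adj a b) {v : V} (hv : v ∈ I) :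
    I.card + G.degree v ≤ Fintype.card V := by
  have hdisj : Disjoint I (G.neighborFinset v) :=
    Finset.disjoint_left.2 fun w hw h => hI v hv w hw ((G.mem_neighborFinset v w).1 h)
  rw [← G.card_neighborFinset_eq_degree, ← Finset.card_union_of_disjoint hdisj]
  exact Finset.card_le_univ _

/-- Let `G` be a splitgraph on `n` vertices with split partition `{S, C}`,
`C ≠ ∅`, and let `d` be the minimum degree in `G` of a vertex of `C`. Then the
maximum of `|I|/(|I| + |N(I)|)` over all independent sets `I` containing
exactly one vertex of `C` equals `(n − d)/n`. -/
theorem split_a1_eq {V : Type*} [Fintype V] [DecidableEq V]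
    (G : SimpleGraph V) [DecidableRel G.Adj]
    (S C : Finset V) (hdisj : Disjoint S C) (hcover : S ∪ C = Finset.univ)
    (hS : ∀ a ∈ S, ∀ b ∈ S, ¬ G.Adj a b)
    (hC : ∀ a ∈ C, ∀ b ∈ C, a ≠ b → G.Adj a b)
    (hCne : C.Nonempty)
    (d : ℕ) (hd : d = C.inf' hCne (fun v => G.degree v)) :
    IsGreatest
      {q : ℝ | ∃ I : Finset V,
        (∀ a ∈ I, ∀ b ∈ I, ¬ G.Adj a b) ∧ (I ∩ C).card = 1 ∧
        q = (I.card : ℝ) / ((I.card : ℝ) + ((setNbhd G I).card : ℝ))}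
      (((Fintype.card V : ℝ) - (d : ℝ)) / (Fintype.card V : ℝ)) := by
  constructor
  · obtain ⟨v, hvC, hv⟩ := C.exists_mem_eq_inf' hCne (fun v => G.degree v)
    have hdv : d = G.degree v := hd.trans hv
    have hvI : v ∈ (G.neighborFinset v)ᶜ := by simp
    have hC_sub : ∀ w ∈ C, ¬ G.Adj v w → w = v := fun w hw h => by
      by_contra hne
      exact h (hC v hvC w hw (Ne.symm hne))
    have hS_of : ∀ w, w ≠ v → ¬ G.Adj v w → w ∈ S := fun w hne h => by
      have hw : w ∈ S ∪ C := hcover ▸ Finset.mem_univ w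
      exact (Finset.mem_union.1 hw).resolve_right fun hwC => hne (hC_sub w hwC h)
    have hI : ∀ a ∈ (G.neighborFinset v)ᶜ, ∀ b ∈ (G.neighborFinset v)ᶜ, ¬ G.Adj a b := by
      intro a ha b hb hab
      simp only [Finset.mem_compl, SimpleGraph.mem_neighborFinset] at ha hb
      by_cases hav : a = v
      · exact hb (hav ▸ hab)
      by_cases hbv : b = v
      · exact ha (hbv ▸ hab.symm)
      exact hS a (hS_of a hav ha) b (hS_of b hbv hb) hab
    have hN : setNbhd G (G.neighborFinset v)ᶜ = G.neighborFinset v := by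
      refine subset_antisymm (fun w hw => ?_) (neighborFinset_subset_setNbhd G hI hvI)
      simpa using (Finset.mem_filter.1 hw).2.1
    refine ⟨(G.neighborFinset v)ᶜ, hI, ?_, ?_⟩
    · refine Finset.card_eq_one.2 ⟨v, ?_⟩
      ext w
      simp only [Finset.mem_inter, Finset.mem_compl, SimpleGraph.mem_neighborFinset,
        Finset.mem_singleton]
      refine ⟨fun h => hC_sub w h.2 h.1, ?_⟩
      rintro rfl
      exact ⟨G.irrefl, hvC⟩
    · have hcard : (((G.neighborFinset v)ᶜ.card : ℕ) : ℝ) + (d : ℝ) = Fintype.card V := by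
        rw [hdv, ← G.card_neighborFinset_eq_degree]
        exact_mod_cast Finset.card_compl_add_card _
      rw [hN, G.card_neighborFinset_eq_degree, ← hdv, hcard, ← hcard, add_sub_cancel_right]
  · rintro q ⟨I, hI, hIC, rfl⟩
    obtain ⟨v, hv⟩ := Finset.card_eq_one.1 hIC
    obtain ⟨hvI, hvC⟩ := Finset.mem_inter.1 (hv ▸ Finset.mem_singleton_self v)
    have hdv : d ≤ G.degree v := hd ▸ Finset.inf'_le _ hvC
    have hN : d ≤ (setNbhd G I).card := hdv.trans
      (G.card_neighborFinset_eq_degree v ▸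
        Finset.card_le_card (neighborFinset_subset_setNbhd G hI hvI))
    have hn : I.card + d ≤ Fintype.card V :=
      (Nat.add_le_add_left hdv _).trans (card_add_degree_le G hI hvI)
    have hpos : 0 < I.card := Finset.card_pos.2 ⟨v, hvI⟩
    have hN' : (d : ℝ) ≤ (setNbhd G I).card := by exact_mod_cast hN
    have hn' : (I.card : ℝ) + d ≤ Fintype.card V := by exact_mod_cast hn
    have hpos' : (0 : ℝ) < I.card := by exact_mod_cast hpos
    have hd0 : (0 : ℝ) ≤ d := Nat.cast_nonneg d
    rw [div_le_div_iff₀ (by linarith) (by linarith)]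
    nlinarith [mul_nonneg (sub_nonneg.2 hn') hd0,
      mul_nonneg (sub_nonneg.2 hN') (show (0 : ℝ) ≤ Fintype.card V - d by linarith)]
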